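/- Let φ be an Orlicz N-function. For any x = (x(i)) ∈ λ_{φ,w}, setting x_n = x·χ_{{1,2,...,n}}, one has lim_{n→∞} ‖x − x_n‖ = lim_{n→∞} ‖x − x_n‖⁰ = θ(x). -/

import Mathlib

open MeasureTheory Set Filter Topology ENNReal

noncomputable section

namespace OL

/-- The complementary Orlicz function `φ_*(v) = sup{uv - φ(u) : u ≥ 0}`. -/
def conj (φ : ℝ → ℝ) (v : ℝ) : ℝ := sSup {x : ℝ | ∃ u : ℝ, 0 ≤ u ∧ x = u * v - φ u}

/-- Orlicz function. -/
def IsOrlicz (φ : ℝ → ℝ) : Prop :=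
  ConvexOn ℝ (Ici 0) φ ∧ φ 0 = 0 ∧ ∀ t : ℝ, 0 < t → 0 < φ t

/-- Orlicz `N`-function. -/
def IsN (φ : ℝ → ℝ) : Prop :=
  IsOrlicz φ ∧ Tendsto (fun t => φ t / t) (𝓝[>] (0:ℝ)) (𝓝 0) ∧
    Tendsto (fun t => φ t / t) atTop atTop

/-- `p` is the right derivative of `φ` on `[0,∞)`. -/
def IsRightDeriv (φ p : ℝ → ℝ) : Prop :=
  ∀ u : ℝ, 0 ≤ u → HasDerivWithinAt φ (p u) (Ici u) u

/-- The `Δ₂⁰` condition. -/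
def Delta20 (φ : ℝ → ℝ) : Prop :=
  ∃ K u₀ : ℝ, 0 < K ∧ 0 < u₀ ∧ ∀ u : ℝ, 0 < u → u ≤ u₀ → φ (2 * u) ≤ K * φ u

/-- Distribution of a sequence: number (in `ℕ∞`) of coordinates with `|x j| > l`. -/
def sdf (x : ℕ → ℝ) (l : ℝ) : ℕ∞ := {j : ℕ | l < |x j|}.encard

/-- Decreasing rearrangement of a sequence (indexed from `0`). -/
def srear (x : ℕ → ℝ) (i : ℕ) : ℝ := sInf {l : ℝ | 0 < l ∧ sdf x l ≤ (i : ℕ∞)}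

/-- The modular `α_{φ,w}(x) = Σ φ(x^*(i)) w(i)`. -/
def amod (φ : ℝ → ℝ) (w x : ℕ → ℝ) : ℝ≥0∞ := ∑' i : ℕ, ENNReal.ofReal (φ (srear x i) * w i)

/-- Membership in the Orlicz–Lorentz sequence space `λ_{φ,w}`. -/
def MemS (φ : ℝ → ℝ) (w x : ℕ → ℝ) : Prop :=
  ∃ l : ℝ, 0 < l ∧ amod φ w (fun i => l * x i) < ⊤

/-- Membership in the order-continuous part `(λ_{φ,w})_a`. -/
def MemSa (φ : ℝ → ℝ) (w x : ℕ → ℝ) : Prop :=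
  ∀ l : ℝ, 0 < l → amod φ w (fun i => l * x i) < ⊤

/-- The Luxemburg norm on `λ_{φ,w}`. -/
def slux (φ : ℝ → ℝ) (w x : ℕ → ℝ) : ℝ :=
  sInf {ε : ℝ | 0 < ε ∧ amod φ w (fun i => x i / ε) ≤ 1}

/-- The Orlicz norm on `λ_{φ,w}` (with values in `ℝ≥0∞`). -/
def sorl (φ : ℝ → ℝ) (w x : ℕ → ℝ) : ℝ≥0∞ :=
  ⨆ g ∈ {g : ℕ → ℝ | amod (conj φ) w g ≤ 1},
    ∑' i : ℕ, ENNReal.ofReal (srear x i * srear g i * w i)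

/-- `θ(x) = inf{η > 0 : α_{φ,w}(x/η) < ∞}`. -/
def stheta (φ : ℝ → ℝ) (w x : ℕ → ℝ) : ℝ :=
  sInf {l : ℝ | 0 < l ∧ amod φ w (fun i => x i / l) < ⊤}

/-- An admissible weight sequence: positive, decreasing, with `Σ w = ∞`. -/
def IsSWeight (w : ℕ → ℝ) : Prop :=
  (∀ i : ℕ, 0 < w i) ∧ (∀ i j : ℕ, i ≤ j → w j ≤ w i) ∧
  (∑' i : ℕ, ENNReal.ofReal (w i)) = ⊤

/-- Linearity of a functional on the subspace `λ_{φ,w}`. -/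
def sIsLin (φ : ℝ → ℝ) (w : ℕ → ℝ) (S : (ℕ → ℝ) → ℝ) : Prop :=
  (∀ x y : ℕ → ℝ, MemS φ w x → MemS φ w y → S (x + y) = S x + S y) ∧
  (∀ (c : ℝ) (x : ℕ → ℝ), MemS φ w x → S (c • x) = c * S x)

/-- Boundedness with respect to the Luxemburg norm. -/
def sBddLux (φ : ℝ → ℝ) (w : ℕ → ℝ) (S : (ℕ → ℝ) → ℝ) : Prop :=
  ∃ C : ℝ, ∀ x : ℕ → ℝ, MemS φ w x → |S x| ≤ C * slux φ w x

/-- Boundedness with respect to the Orlicz norm. -/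
def sBddOrl (φ : ℝ → ℝ) (w : ℕ → ℝ) (S : (ℕ → ℝ) → ℝ) : Prop :=
  ∃ C : ℝ, 0 ≤ C ∧ ∀ x : ℕ → ℝ, MemS φ w x →
    ENNReal.ofReal |S x| ≤ ENNReal.ofReal C * sorl φ w x

/-- A singular functional: bounded, linear, vanishing on the order-continuous part. -/
def sIsSingular (φ : ℝ → ℝ) (w : ℕ → ℝ) (S : (ℕ → ℝ) → ℝ) : Prop :=
  sIsLin φ w S ∧ sBddLux φ w S ∧ ∀ x : ℕ → ℝ, MemSa φ w x → S x = 0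

/-- Operator norm with respect to the Luxemburg norm. -/
def sOpLux (φ : ℝ → ℝ) (w : ℕ → ℝ) (S : (ℕ → ℝ) → ℝ) : ℝ :=
  sSup {r : ℝ | ∃ x : ℕ → ℝ, MemS φ w x ∧ slux φ w x ≤ 1 ∧ r = S x}

/-- Operator norm with respect to the Orlicz norm. -/
def sOpOrl (φ : ℝ → ℝ) (w : ℕ → ℝ) (S : (ℕ → ℝ) → ℝ) : ℝ :=
  sSup {r : ℝ | ∃ x : ℕ → ℝ, MemS φ w x ∧ sorl φ w x ≤ 1 ∧ r = S x}

/-- `v ≺ w` for sequences: `Σ_{i<n} v^*(i) ≤ Σ_{i<n} w(i)` for all `n`, `v` nonnegative. -/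
def sPrec (w v : ℕ → ℝ) : Prop :=
  (∀ i : ℕ, 0 ≤ v i) ∧
  ∀ n : ℕ, (∑ i ∈ Finset.range n, srear v i) ≤ ∑ i ∈ Finset.range n, w i

/-- The modular `p_{ψ,w}(h) = inf{Σ ψ(|h(i)|/v(i)) v(i) : v ≥ 0, v ≺ w}`. -/
def sP (ψ : ℝ → ℝ) (w h : ℕ → ℝ) : ℝ≥0∞ :=
  ⨅ v ∈ {v : ℕ → ℝ | sPrec w v}, ∑' i : ℕ, ENNReal.ofReal (ψ (|h i| / v i) * v i)

/-- Luxemburg norm of the space `m_{ψ,w}` (real-valued). -/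
def sMlux (ψ : ℝ → ℝ) (w h : ℕ → ℝ) : ℝ :=
  sInf {ε : ℝ | 0 < ε ∧ sP ψ w (fun i => h i / ε) ≤ 1}

/-- Luxemburg norm of the space `m_{ψ,w}` (`ℝ≥0∞`-valued; `∞` when `h ∉ m_{ψ,w}`). -/
def sMluxE (ψ : ℝ → ℝ) (w h : ℕ → ℝ) : ℝ≥0∞ :=
  sInf {e : ℝ≥0∞ | ∃ ε : ℝ, 0 < ε ∧ e = ENNReal.ofReal ε ∧ sP ψ w (fun i => h i / ε) ≤ 1}

/-- Orlicz norm of the space `m_{ψ,w}`: `inf_{k>0} (1/k)(1 + p_{ψ,w}(kh))`. -/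
def sMorl (ψ : ℝ → ℝ) (w h : ℕ → ℝ) : ℝ≥0∞ :=
  ⨅ k ∈ Ioi (0:ℝ), (ENNReal.ofReal k)⁻¹ * (1 + sP ψ w (fun i => k * h i))

lemma phi_nonneg {φ : ℝ → ℝ} (h : IsOrlicz φ) {t : ℝ} (ht : 0 ≤ t) : 0 ≤ φ t := by
  rcases ht.eq_or_lt with rfl | h0
  · exact h.2.1.ge
  · exact (h.2.2 t h0).le

/-- `φ (c t) ≤ c φ t` for `0 ≤ c ≤ 1`. -/
lemma phi_smul {φ : ℝ → ℝ} (h : IsOrlicz φ) {c t : ℝ} (hc : 0 ≤ c) (hc1 : c ≤ 1) (ht : 0 ≤ t) :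
    φ (c * t) ≤ c * φ t := by
  have := h.1.2 (show t ∈ Ici (0:ℝ) from ht) (show (0:ℝ) ∈ Ici (0:ℝ) by simp) hc
    (show 0 ≤ 1 - c by linarith) (by ring)
  simpa [h.2.1] using this

lemma phi_mono {φ : ℝ → ℝ} (h : IsOrlicz φ) {s t : ℝ} (hs : 0 ≤ s) (hst : s ≤ t) : φ s ≤ φ t := by
  rcases (hs.trans hst).eq_or_lt with h0 | h0
  · have : s = t := by linarith
    rw [this]
  · have h1 := phi_smul h (c := s / t) (t := t) (by positivity) ((div_le_one h0).2 hst) h0.le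
    rw [div_mul_cancel₀ _ h0.ne'] at h1
    have h2 : s / t * φ t ≤ 1 * φ t :=
      mul_le_mul_of_nonneg_right ((div_le_one h0).2 hst) (phi_nonneg h h0.le)
    linarith

lemma phi_tendsto {φ : ℝ → ℝ} (h : IsOrlicz φ) {a : ℕ → ℝ} (ha : ∀ n, 0 ≤ a n)
    (hl : Tendsto a atTop (𝓝 0)) : Tendsto (fun n => φ (a n)) atTop (𝓝 0) := by
  have h1 : Tendsto (fun n => a n * φ 1) atTop (𝓝 0) := by simpa using hl.mul_const (φ 1)
  refine tendsto_of_tendsto_of_tendsto_of_le_of_le' tendsto_const_nhds h1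
    (Eventually.of_forall fun n => phi_nonneg h (ha n)) ?_
  filter_upwards [hl.eventually (ge_mem_nhds (show (0:ℝ) < 1 by norm_num))] with n hn
  simpa using phi_smul h (ha n) hn zero_le_one

lemma exists_subgrad {φ : ℝ → ℝ} (h : IsOrlicz φ) (u : ℝ) :
    ∃ p : ℝ, 0 ≤ u → 0 ≤ p ∧ ∀ t, 0 ≤ t → φ u + p * (t - u) ≤ φ t := by
  rcases lt_trichotomy u 0 with hu | rfl | hu
  · exact ⟨0, fun h => absurd h (not_le.2 hu)⟩
  · exact ⟨0, fun _ => ⟨le_rfl, fun t ht => by simpa [h.2.1] using phi_nonneg h ht⟩⟩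
  · have hi : u ∈ interior (Ici (0:ℝ)) := by simpa using hu
    have key : ∀ t, 0 ≤ t → φ u + derivWithin φ (Ioi u) u * (t - u) ≤ φ t := by
      intro t ht
      rcases lt_trichotomy t u with htu | rfl | htu
      · have h1 := h.1.slope_le_leftDeriv_of_mem_interior ht hi htu
        have h2 := h.1.leftDeriv_le_rightDeriv_of_mem_interior hi
        have h3 := h1.trans h2
        rw [slope_def_field, div_le_iff₀ (by linarith)] at h3
        linarith
      · simp
      · have h1 := h.1.rightDeriv_le_slope_of_mem_interior hi ht htu
        rw [slope_def_field, le_div_iff₀ (by linarith)] at h1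
        linarith
    refine ⟨_, fun _ => ⟨?_, key⟩⟩
    have h0 := key 0 le_rfl
    rw [h.2.1] at h0
    have := h.2.2 u hu
    by_contra hneg
    push Not at hneg
    nlinarith

/-- Young's inequality. -/
lemma young {φ : ℝ → ℝ} (h : IsN φ) {u v : ℝ} (hu : 0 ≤ u) (hv : 0 ≤ v) :
    u * v ≤ φ u + conj φ v := by
  have hb : BddAbove {x : ℝ | ∃ u : ℝ, 0 ≤ u ∧ x = u * v - φ u} := by
    obtain ⟨M, hM⟩ := (h.2.2.eventually_ge_atTop v).exists_forall_of_atTop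
    refine ⟨max M 0 * v, ?_⟩
    rintro _ ⟨t, ht, rfl⟩
    have hp := phi_nonneg h.1 ht
    rcases le_total t (max M 0) with h1 | h1
    · nlinarith
    · rcases ht.eq_or_lt with rfl | ht0
      · have : 0 ≤ max M 0 * v := mul_nonneg (le_max_right _ _) hv
        linarith
      · have h2 := hM t ((le_max_left _ _).trans h1)
        rw [le_div_iff₀ ht0] at h2
        have : 0 ≤ max M 0 * v := mul_nonneg (le_max_right _ _) hv
        linarith
  have : u * v - φ u ≤ conj φ v := le_csSup hb ⟨u, hu, rfl⟩
  linarith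

lemma srear_nonneg (x : ℕ → ℝ) (i : ℕ) : 0 ≤ srear x i :=
  Real.sInf_nonneg fun _ h => h.1.le

lemma srear_le {x : ℕ → ℝ} {i : ℕ} {l : ℝ} (hl : 0 < l) (h : sdf x l ≤ i) : srear x i ≤ l :=
  csInf_le ⟨0, fun _ h => h.1.le⟩ ⟨hl, h⟩

open scoped Pointwise in
lemma srear_div (x : ℕ → ℝ) {c : ℝ} (hc : 0 < c) (i : ℕ) :
    srear (fun j => x j / c) i = srear x i / c := by
  have key : {l : ℝ | 0 < l ∧ sdf (fun j => x j / c) l ≤ (i : ℕ∞)}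
      = c⁻¹ • {l : ℝ | 0 < l ∧ sdf x l ≤ (i : ℕ∞)} := by
    ext l
    rw [Set.mem_smul_set_iff_inv_smul_mem₀ (inv_ne_zero hc.ne')]
    have : sdf (fun j => x j / c) l = sdf x (c * l) := by
      unfold sdf
      congr 1
      ext j
      simp only [mem_ofPred_eq, abs_div, abs_of_pos hc]
      rw [lt_div_iff₀ hc, mul_comm]
    simp [this, hc]
  unfold srear
  rw [key, Real.sInf_smul_of_nonneg (by positivity), smul_eq_mul, div_eq_inv_mul]

lemma bdd_of_sdf {x : ℕ → ℝ} {l : ℝ} (h : sdf x l < ⊤) : ∃ L, 0 < L ∧ ∀ j, |x j| ≤ L := by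
  have hf : {j : ℕ | l < |x j|}.Finite := Set.encard_lt_top_iff.1 h
  obtain ⟨B, hB⟩ := (hf.image fun j => |x j|).bddAbove
  refine ⟨max (max B l) 1, by positivity, fun j => ?_⟩
  by_cases hj : l < |x j|
  · exact (hB ⟨j, hj, rfl⟩).trans ((le_max_left _ _).trans (le_max_left _ _))
  · exact (not_lt.1 hj).trans ((le_max_right _ _).trans (le_max_left _ _))

lemma sdf_zero_of_bdd {x : ℕ → ℝ} {L : ℝ} (h : ∀ j, |x j| ≤ L) : sdf x L = 0 := by
  simp [sdf, Set.encard_eq_zero, Set.eq_empty_iff_forall_notMem, h]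

/-- the tail -/
def tl (x : ℕ → ℝ) (n : ℕ) : ℕ → ℝ := fun i => x i - (if i < n then x i else 0)

lemma tl_abs_le (x : ℕ → ℝ) (n j : ℕ) : |tl x n j| ≤ |x j| := by
  unfold tl; split_ifs <;> simp

lemma sdf_tl_le (x : ℕ → ℝ) (n : ℕ) (l : ℝ) : sdf (tl x n) l ≤ sdf x l :=
  Set.encard_le_encard fun j hj => lt_of_lt_of_le hj (tl_abs_le x n j)

lemma sdf_le_tl (x : ℕ → ℝ) (n : ℕ) (l : ℝ) : sdf x l ≤ sdf (tl x n) l + n := by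
  have h : {j : ℕ | l < |x j|} ⊆ {j : ℕ | l < |tl x n j|} ∪ (Finset.range n : Set ℕ) := by
    intro j hj
    by_cases hjn : j < n
    · right; simpa using hjn
    · left; simpa [tl, hjn] using hj
  refine (Set.encard_le_encard h).trans ((Set.encard_union_le _ _).trans ?_)
  rw [Set.encard_coe_eq_coe_finsetCard]
  simp [sdf]

lemma srear_tl_le (x : ℕ → ℝ) (n i : ℕ) : srear (tl x n) i ≤ srear x i := by
  by_cases hne : {l : ℝ | 0 < l ∧ sdf x l ≤ (i : ℕ∞)}.Nonempty
  · exact csInf_le_csInf ⟨0, fun _ h => h.1.le⟩ hne fun l hl => ⟨hl.1, (sdf_tl_le x n l).trans hl.2⟩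
  · have : {l : ℝ | 0 < l ∧ sdf (tl x n) l ≤ (i : ℕ∞)} = ∅ := by
      by_contra h
      obtain ⟨l, hl⟩ := Set.nonempty_iff_ne_empty.2 h
      have h1 : sdf x l < ⊤ := lt_of_le_of_lt ((sdf_le_tl x n l).trans (add_le_add_left hl.2 _))
        (by exact_mod_cast ENat.natCast_lt_top (i + n))
      obtain ⟨L, hL, hb⟩ := bdd_of_sdf h1
      exact hne ⟨L, hL, by simp [sdf_zero_of_bdd hb]⟩
    rw [srear, this, Real.sInf_empty]
    exact srear_nonneg _ _

lemma srear_le_tl (x : ℕ → ℝ) (n i : ℕ) : srear x (i + n) ≤ srear (tl x n) i := by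
  by_cases hne : {l : ℝ | 0 < l ∧ sdf (tl x n) l ≤ (i : ℕ∞)}.Nonempty
  · refine csInf_le_csInf ⟨0, fun _ h => h.1.le⟩ hne fun l hl => ⟨hl.1, ?_⟩
    refine (sdf_le_tl x n l).trans ((add_le_add_left hl.2 _).trans ?_)
    simp
  · have : {l : ℝ | 0 < l ∧ sdf x l ≤ ((i + n : ℕ) : ℕ∞)} = ∅ := by
      by_contra h
      obtain ⟨l, hl⟩ := Set.nonempty_iff_ne_empty.2 h
      have h1 : sdf x l < ⊤ := lt_of_le_of_lt hl.2 (ENat.natCast_lt_top (i + n))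
      obtain ⟨L, hL, hb⟩ := bdd_of_sdf h1
      refine hne ⟨L, hL, ?_⟩
      rw [sdf_zero_of_bdd fun j => (tl_abs_le x n j).trans (hb j)]
      simp
    rw [srear, this, Real.sInf_empty]
    exact srear_nonneg _ _

lemma srear_antitone_eq {g : ℕ → ℝ} (h0 : ∀ i, 0 ≤ g i) (hg : Antitone g) (i : ℕ) :
    srear g i = g i := by
  apply le_antisymm
  · refine le_of_forall_pos_le_add fun ε hε => ?_
    have hp : 0 < g i + ε := by linarith [h0 i]
    refine srear_le hp ?_
    have : {j : ℕ | g i + ε < |g j|} ⊆ (Finset.range i : Set ℕ) := by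
      intro j hj
      simp only [mem_ofPred_eq, abs_of_nonneg (h0 j)] at hj
      by_contra hc
      have := hg (show i ≤ j by simpa using hc)
      linarith
    refine (Set.encard_le_encard this).trans ?_
    rw [Set.encard_coe_eq_coe_finsetCard]; simp
  · refine le_csInf ⟨g 0 + 1, by linarith [h0 0], ?_⟩ ?_
    · rw [sdf_zero_of_bdd]
      · simp
      · intro j
        rw [abs_of_nonneg (h0 j)]
        linarith [hg (Nat.zero_le j)]
    · rintro l ⟨hl, hs⟩
      by_contra hc
      push Not at hc
      have : ((Finset.range (i+1) : Finset ℕ) : Set ℕ) ⊆ {j : ℕ | l < |g j|} := by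
        intro j hj
        simp only [Finset.coe_range, mem_Iio] at hj
        simp only [mem_ofPred_eq, abs_of_nonneg (h0 j)]
        exact lt_of_lt_of_le hc (hg (by omega))
      have h2 := (Set.encard_le_encard this).trans hs
      rw [Set.encard_coe_eq_coe_finsetCard, Finset.card_range] at h2
      have : i + 1 ≤ i := by exact_mod_cast h2
      omega

lemma srear_anti (x : ℕ → ℝ) : Antitone (srear x) := by
  intro i k hik
  by_cases hne : {l : ℝ | 0 < l ∧ sdf x l ≤ (i : ℕ∞)}.Nonempty
  · exact csInf_le_csInf ⟨0, fun _ h => h.1.le⟩ hne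
      fun l hl => ⟨hl.1, hl.2.trans (by exact_mod_cast hik)⟩
  · have : {l : ℝ | 0 < l ∧ sdf x l ≤ (k : ℕ∞)} = ∅ := by
      by_contra h
      obtain ⟨l, hl⟩ := Set.nonempty_iff_ne_empty.2 h
      obtain ⟨L, hL, hb⟩ := bdd_of_sdf (lt_of_le_of_lt hl.2 (ENat.natCast_lt_top k))
      exact hne ⟨L, hL, by simp [sdf_zero_of_bdd hb]⟩
    have h2 : srear x k = 0 := by rw [srear, this, Real.sInf_empty]
    rw [h2]
    exact srear_nonneg _ _

/-- monotonicity of the modular -/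
lemma amod_mono {φ : ℝ → ℝ} (h : IsOrlicz φ) {w : ℕ → ℝ} (hw : IsSWeight w) {x y : ℕ → ℝ}
    (hxy : ∀ i, srear x i ≤ srear y i) : amod φ w x ≤ amod φ w y :=
  ENNReal.tsum_le_tsum fun i => ENNReal.ofReal_le_ofReal
    (mul_le_mul_of_nonneg_right (phi_mono h (srear_nonneg _ _) (hxy i)) (hw.1 i).le)

lemma amod_div {φ : ℝ → ℝ} {w x : ℕ → ℝ} {c : ℝ} (hc : 0 < c) :
    amod φ w (fun i => x i / c) = ∑' i, ENNReal.ofReal (φ (srear x i / c) * w i) := by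
  simp only [amod, srear_div x hc]

lemma memS_div {φ : ℝ → ℝ} {w x : ℕ → ℝ} (hx : MemS φ w x) :
    ∃ c : ℝ, 0 < c ∧ amod φ w (fun i => x i / c) < ⊤ := by
  obtain ⟨l, hl, h⟩ := hx
  refine ⟨l⁻¹, inv_pos.2 hl, ?_⟩
  simpa [div_eq_mul_inv, mul_comm] using h

lemma srear_tl_tendsto {φ : ℝ → ℝ} (h : IsOrlicz φ) {w : ℕ → ℝ} (hw : IsSWeight w) {x : ℕ → ℝ}
    (hx : MemS φ w x) (i : ℕ) : Tendsto (fun n => srear (tl x n) i) atTop (𝓝 0) := by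
  by_cases hb : ∃ L, 0 < L ∧ ∀ j, |x j| ≤ L
  · obtain ⟨L, hL, hb⟩ := hb
    have hfin : ∀ ε > 0, sdf x ε < ⊤ := by
      intro ε hε
      by_contra hinf
      have hinf : sdf x ε = ⊤ := not_lt_top_iff.1 hinf
      have hge : ∀ i, ε ≤ srear x i := by
        intro i
        refine le_csInf ⟨L, hL, by simp [sdf_zero_of_bdd hb]⟩ ?_
        rintro l ⟨hl, hs⟩
        by_contra hc
        push Not at hc
        have : sdf x ε ≤ sdf x l := Set.encard_le_encard fun j hj => lt_trans hc hj
        rw [hinf] at this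
        exact absurd (this.trans hs) (not_le.2 (ENat.natCast_lt_top i))
      obtain ⟨c, hc, hfin⟩ := memS_div hx
      rw [amod_div hc] at hfin
      have hle : ∑' i, ENNReal.ofReal (φ (ε / c)) * ENNReal.ofReal (w i)
          ≤ ∑' i, ENNReal.ofReal (φ (srear x i / c) * w i) := by
        refine ENNReal.tsum_le_tsum fun i => ?_
        rw [← ENNReal.ofReal_mul (phi_nonneg h (by positivity))]
        refine ENNReal.ofReal_le_ofReal (mul_le_mul_of_nonneg_right
          (phi_mono h (by positivity) ?_) (hw.1 i).le)
        exact div_le_div_of_nonneg_right (hge i) hc.le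
      rw [ENNReal.tsum_mul_left, hw.2.2, ENNReal.mul_top] at hle
      · exact absurd (lt_of_le_of_lt hle hfin) (lt_irrefl _)
      · have := h.2.2 (ε / c) (by positivity)
        simpa using this
    rw [Metric.tendsto_atTop]
    intro ε hε
    have hf : {j : ℕ | ε / 2 < |x j|}.Finite := Set.encard_lt_top_iff.1 (hfin (ε/2) (by positivity))
    obtain ⟨N, hN⟩ := hf.bddAbove
    refine ⟨N + 1, fun n hn => ?_⟩
    rw [Real.dist_eq, sub_zero, abs_of_nonneg (srear_nonneg _ _)]
    have : srear (tl x n) i ≤ ε / 2 := by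
      refine srear_le (by positivity) ?_
      rw [sdf_zero_of_bdd]
      · simp
      · intro j
        by_cases hj : j < n
        · simp [tl, hj]; positivity
        · refine (tl_abs_le x n j).trans ?_
          by_contra hc
          have := hN (show j ∈ {j : ℕ | ε / 2 < |x j|} from not_le.1 hc)
          omega
    linarith
  · have hz : ∀ n, srear (tl x n) i = 0 := by
      intro n
      refine le_antisymm ((srear_tl_le x n i).trans ?_) (srear_nonneg _ _)
      have : {l : ℝ | 0 < l ∧ sdf x l ≤ (i : ℕ∞)} = ∅ := by
        by_contra h
        obtain ⟨l, hl⟩ := Set.nonempty_iff_ne_empty.2 h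
        exact hb (bdd_of_sdf (lt_of_le_of_lt hl.2 (ENat.natCast_lt_top i)))
      rw [srear, this, Real.sInf_empty]
    simp [hz]

/-- Modulars of tails tend to zero. -/
lemma amod_tl_tendsto {φ : ℝ → ℝ} (h : IsOrlicz φ) {w : ℕ → ℝ} (hw : IsSWeight w) {x : ℕ → ℝ}
    (hx : MemS φ w x) {c : ℝ} (hc : 0 < c) (hfin : amod φ w (fun i => x i / c) < ⊤) :
    Tendsto (fun n => amod φ w (fun i => tl x n i / c)) atTop (𝓝 0) := by
  rw [amod_div hc] at hfin
  simp only [amod_div hc]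
  have := tendsto_lintegral_of_dominated_convergence (μ := (Measure.count : Measure ℕ))
    (F := fun n i => ENNReal.ofReal (φ (srear (tl x n) i / c) * w i)) (f := fun _ => 0)
    (fun i => ENNReal.ofReal (φ (srear x i / c) * w i))
    (fun n => measurable_of_countable _)
    (fun n => Eventually.of_forall fun i => ENNReal.ofReal_le_ofReal
      (mul_le_mul_of_nonneg_right (phi_mono h (div_nonneg (srear_nonneg _ _) hc.le)
        (div_le_div_of_nonneg_right (srear_tl_le x n i) hc.le)) (hw.1 i).le))
    (by rw [lintegral_count]; exact hfin.ne)
    (Eventually.of_forall fun i => by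
      have h1 : Tendsto (fun n => srear (tl x n) i / c) atTop (𝓝 0) := by
        simpa using (srear_tl_tendsto h hw hx i).div_const c
      have h2 := phi_tendsto h (fun n => div_nonneg (srear_nonneg _ _) hc.le) h1
      have h3 := ENNReal.tendsto_ofReal (h2.mul_const (w i))
      simpa using h3)
  simpa [lintegral_count] using this

lemma amod_fin_of_tl {φ : ℝ → ℝ} (h : IsOrlicz φ) {w : ℕ → ℝ} (hw : IsSWeight w) {x : ℕ → ℝ}
    {c : ℝ} (hc : 0 < c) (n : ℕ) (hfin : amod φ w (fun i => tl x n i / c) < ⊤) :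
    amod φ w (fun i => x i / c) < ⊤ := by
  rw [amod_div hc] at hfin ⊢
  rw [← ENNReal.summable.sum_add_tsum_nat_add' (k := n)]
  refine ENNReal.add_lt_top.2 ⟨ENNReal.sum_lt_top.2 fun i _ => ENNReal.ofReal_lt_top, ?_⟩
  refine lt_of_le_of_lt (ENNReal.tsum_le_tsum fun i => ENNReal.ofReal_le_ofReal ?_) hfin
  exact mul_le_mul (phi_mono h (div_nonneg (srear_nonneg _ _) hc.le)
    (div_le_div_of_nonneg_right (srear_le_tl x n i) hc.le)) (hw.2.1 _ _ (by omega)) (hw.1 _).le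
    (phi_nonneg h (div_nonneg (srear_nonneg _ _) hc.le))

lemma stheta_le {φ : ℝ → ℝ} {w x : ℕ → ℝ} {c : ℝ} (hc : 0 < c)
    (hfin : amod φ w (fun i => x i / c) < ⊤) : stheta φ w x ≤ c :=
  csInf_le ⟨0, fun _ h => h.1.le⟩ ⟨hc, hfin⟩

lemma stheta_nonneg {φ : ℝ → ℝ} {w x : ℕ → ℝ} : 0 ≤ stheta φ w x :=
  Real.sInf_nonneg fun _ h => h.1.le

lemma fin_of_stheta_lt {φ : ℝ → ℝ} (h : IsOrlicz φ) {w : ℕ → ℝ} (hw : IsSWeight w) {x : ℕ → ℝ}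
    (hx : MemS φ w x) {c : ℝ} (hc : stheta φ w x < c) : amod φ w (fun i => x i / c) < ⊤ := by
  obtain ⟨l, ⟨hl, hf⟩, hlc⟩ := exists_lt_of_csInf_lt (memS_div hx) hc
  refine lt_of_le_of_lt (amod_mono h hw fun i => ?_) hf
  rw [srear_div _ hl, srear_div _ (hl.trans hlc)]
  exact div_le_div_of_nonneg_left (srear_nonneg _ _) hl hlc.le

/-- upper estimate of the Orlicz norm -/
lemma sorl_le {φ : ℝ → ℝ} (h : IsN φ) {w : ℕ → ℝ} (hw : IsSWeight w) (y : ℕ → ℝ)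
    {c : ℝ} (hc : 0 < c) :
    sorl φ w y ≤ ENNReal.ofReal c * (amod φ w (fun i => y i / c) + 1) := by
  refine iSup₂_le fun g hg => ?_
  have hg : amod (conj φ) w g ≤ 1 := hg
  refine le_trans ?_ (mul_le_mul_right (add_le_add_right hg _) _)
  rw [amod_div hc, amod, ← ENNReal.tsum_add, ← ENNReal.tsum_mul_left]
  refine ENNReal.tsum_le_tsum fun i => ?_
  refine le_trans ?_ (mul_le_mul_right ENNReal.ofReal_add_le _)
  rw [← ENNReal.ofReal_mul hc.le]
  refine ENNReal.ofReal_le_ofReal ?_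
  have h1 := young h (div_nonneg (srear_nonneg y i) hc.le) (srear_nonneg g i)
  have h2 := mul_le_mul_of_nonneg_left (mul_le_mul_of_nonneg_right h1 (hw.1 i).le) hc.le
  have h3 : c * (srear y i / c * srear g i * w i) = srear y i * srear g i * w i := by
    field_simp
  linarith

/-- lower estimate of the Orlicz norm -/
lemma amod_le_of_sorl {φ : ℝ → ℝ} (h : IsOrlicz φ) {w : ℕ → ℝ} (hw : IsSWeight w) (y : ℕ → ℝ)
    {c : ℝ} (hc : 0 < c) (hs : sorl φ w y ≤ ENNReal.ofReal c) :
    amod φ w (fun i => y i / c) ≤ 1 := by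
  rw [amod_div hc]
  choose p hp using exists_subgrad h
  set u : ℕ → ℝ := fun i => srear y i / c with hu
  have hu0 : ∀ i, 0 ≤ u i := fun i => div_nonneg (srear_nonneg _ _) hc.le
  have huanti : Antitone u := fun i j hij => div_le_div_of_nonneg_right (srear_anti y hij) hc.le
  have hpm : ∀ s t, 0 ≤ s → s ≤ t → p s ≤ p t := by
    intro s t h0 hst
    rcases hst.eq_or_lt with rfl | hlt
    · exact le_rfl
    · have h1 := (hp s h0).2 t (by linarith)
      have h2 := (hp t (by linarith)).2 s h0
      nlinarith
  refine ENNReal.tsum_le_of_sum_range_le fun N => ?_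
  rw [← ENNReal.ofReal_sum_of_nonneg fun i _ => mul_nonneg (phi_nonneg h (hu0 i)) (hw.1 i).le]
  rw [ENNReal.ofReal_le_one]
  set B : ℝ := ∑ i ∈ Finset.range N, (u i * p (u i) - φ (u i)) * w i with hB
  set A : ℝ := max 1 B with hA
  have hA1 : 1 ≤ A := le_max_left _ _
  have hA0 : 0 < A := by linarith
  set g : ℕ → ℝ := fun i => if i < N then p (u i) / A else 0 with hg
  have hg0 : ∀ i, 0 ≤ g i := by
    intro i
    simp only [hg]
    split_ifs
    · exact div_nonneg (hp _ (hu0 i)).1 hA0.le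
    · exact le_rfl
  have hganti : Antitone g := by
    intro i j hij
    by_cases hj : j < N
    · have hi : i < N := by omega
      simp only [hg, hi, hj, if_true]
      exact div_le_div_of_nonneg_right (hpm _ _ (hu0 j) (huanti hij)) hA0.le
    · have : g j = 0 := by simp [hg, hj]
      rw [this]; exact hg0 i
  have hgs : ∀ i, srear g i = g i := srear_antitone_eq hg0 hganti
  have hub : ∀ i, 0 ≤ u i * p (u i) - φ (u i) := by
    intro i
    have := (hp _ (hu0 i)).2 0 le_rfl
    rw [h.2.1] at this
    linarith
  have hconj : ∀ i, conj φ (p (u i) / A) ≤ (u i * p (u i) - φ (u i)) / A := by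
    intro i
    refine csSup_le ⟨_, 0, le_rfl, rfl⟩ ?_
    rintro _ ⟨t, ht, rfl⟩
    have h1 := (hp _ (hu0 i)).2 t ht
    have h2 := phi_nonneg h ht
    rw [le_div_iff₀ hA0]
    have h3 : (t * (p (u i) / A) - φ t) * A = t * p (u i) - A * φ t := by field_simp
    rw [h3]
    nlinarith
  have hconj0 : conj φ 0 ≤ 0 := by
    refine csSup_le ⟨_, 0, le_rfl, rfl⟩ ?_
    rintro _ ⟨t, ht, rfl⟩
    simpa using phi_nonneg h ht
  have hgmem : amod (conj φ) w g ≤ 1 := by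
    unfold amod
    rw [tsum_eq_sum (s := Finset.range N)]
    · have : ∀ i ∈ Finset.range N, ENNReal.ofReal (conj φ (srear g i) * w i)
          ≤ ENNReal.ofReal ((u i * p (u i) - φ (u i)) / A * w i) := by
        intro i hi
        have hi : i < N := by simpa using hi
        rw [hgs]
        simp only [hg, hi, if_true]
        exact ENNReal.ofReal_le_ofReal (mul_le_mul_of_nonneg_right (hconj i) (hw.1 i).le)
      refine (Finset.sum_le_sum this).trans ?_
      rw [← ENNReal.ofReal_sum_of_nonneg fun i _ =>
        mul_nonneg (div_nonneg (hub i) hA0.le) (hw.1 i).le]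
      rw [ENNReal.ofReal_le_one]
      have : ∑ i ∈ Finset.range N, (u i * p (u i) - φ (u i)) / A * w i = B / A := by
        rw [hB, Finset.sum_div]
        exact Finset.sum_congr rfl fun i _ => by ring
      rw [this, div_le_one hA0]
      exact le_max_right _ _
    · intro i hi
      have hi : ¬ i < N := by simpa using hi
      rw [hgs]
      simp only [hg, hi, if_false]
      exact ENNReal.ofReal_of_nonpos (mul_nonpos_of_nonpos_of_nonneg hconj0 (hw.1 i).le)
  have hle : ∑' i : ℕ, ENNReal.ofReal (srear y i * srear g i * w i) ≤ ENNReal.ofReal c :=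
    le_trans (le_iSup₂ (f := fun (g : ℕ → ℝ) (_ : g ∈ {g : ℕ → ℝ | amod (conj φ) w g ≤ 1}) =>
      ∑' i : ℕ, ENNReal.ofReal (srear y i * srear g i * w i)) g hgmem) hs
  have hle2 := (ENNReal.sum_le_tsum (Finset.range N)).trans hle
  rw [← ENNReal.ofReal_sum_of_nonneg fun i _ =>
    mul_nonneg (mul_nonneg (srear_nonneg _ _) (srear_nonneg _ _)) (hw.1 i).le,
    ENNReal.ofReal_le_ofReal_iff hc.le] at hle2
  have heq : ∑ i ∈ Finset.range N, srear y i * srear g i * w i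
      = c / A * (B + ∑ i ∈ Finset.range N, φ (u i) * w i) := by
    rw [hB, ← Finset.sum_add_distrib, Finset.mul_sum]
    refine Finset.sum_congr rfl fun i hi => ?_
    have hi : i < N := by simpa using hi
    rw [hgs]
    simp only [hg, hi, if_true]
    have : srear y i = c * u i := by simp only [hu]; field_simp
    rw [this]
    ring
  rw [heq, div_mul_eq_mul_div, div_le_iff₀ hA0] at hle2
  have h5 := le_of_mul_le_mul_left hle2 hc
  have hBn : 0 ≤ B := Finset.sum_nonneg fun i _ => mul_nonneg (hub i) (hw.1 i).le
  rcases max_cases 1 B with ⟨h6, _⟩ | ⟨h6, _⟩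
  · rw [← hA] at h6; linarith
  · rw [← hA] at h6; linarith

/-- for `x ∈ λ_{φ,w}` and `x_n = x·χ_{{1,...,n}}`,
`lim ‖x - x_n‖ = lim ‖x - x_n‖⁰ = θ(x)`. -/
theorem statement5 (w : ℕ → ℝ) (hw : IsSWeight w) (φ : ℝ → ℝ) (hφ : IsN φ)
    (x : ℕ → ℝ) (hx : MemS φ w x) :
    Tendsto (fun n : ℕ => slux φ w (fun i => x i - (if i < n then x i else 0)))
      atTop (𝓝 (stheta φ w x)) ∧
    Tendsto (fun n : ℕ => sorl φ w (fun i => x i - (if i < n then x i else 0)))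
      atTop (𝓝 (ENNReal.ofReal (stheta φ w x))) := by
  change Tendsto (fun n : ℕ => slux φ w (tl x n)) atTop (𝓝 (stheta φ w x)) ∧
    Tendsto (fun n : ℕ => sorl φ w (tl x n)) atTop (𝓝 (ENNReal.ofReal (stheta φ w x)))
  have hO := hφ.1
  have hpos : ∀ {c : ℝ}, stheta φ w x < c → 0 < c := fun h => lt_of_le_of_lt stheta_nonneg h
  have hev : ∀ {c : ℝ}, stheta φ w x < c →
      Tendsto (fun n => amod φ w (fun i => tl x n i / c)) atTop (𝓝 0) := fun h =>
    amod_tl_tendsto hO hw hx (hpos h) (fin_of_stheta_lt hO hw hx h)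
  constructor
  · refine tendsto_order.2 ⟨fun a ha => ?_, fun a ha => ?_⟩
    · have h1 : stheta φ w x < stheta φ w x + 1 := by linarith
      filter_upwards [(hev h1).eventually (ge_mem_nhds (show (0:ℝ≥0∞) < 1 by simp))] with n hn
      refine lt_of_lt_of_le ha (le_csInf ⟨_, hpos h1, hn⟩ ?_)
      rintro c ⟨hc, hc1⟩
      exact stheta_le hc (amod_fin_of_tl hO hw hc n (lt_of_le_of_lt hc1 ENNReal.one_lt_top))
    · obtain ⟨b, hb, hba⟩ := exists_between ha
      filter_upwards [(hev hb).eventually (ge_mem_nhds (show (0:ℝ≥0∞) < 1 by simp))] with n hn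
      exact lt_of_le_of_lt (csInf_le ⟨0, fun _ h => h.1.le⟩ ⟨hpos hb, hn⟩) hba
  · refine tendsto_order.2 ⟨fun a ha => Eventually.of_forall fun n => lt_of_lt_of_le ha ?_,
      fun a ha => ?_⟩
    · by_contra hlt
      push Not at hlt
      obtain ⟨c, hc0, hc1, hc2⟩ := ENNReal.lt_iff_exists_real_btwn.1 hlt
      have hc : 0 < c := ENNReal.ofReal_pos.1 (lt_of_le_of_lt zero_le hc1)
      have h1 := amod_le_of_sorl hO hw _ hc hc1.le
      have h2 := stheta_le hc (amod_fin_of_tl hO hw hc n (lt_of_le_of_lt h1 ENNReal.one_lt_top))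
      exact absurd hc2 (not_lt.2 (ENNReal.ofReal_le_ofReal h2))
    · obtain ⟨b, hb0, hb, hba⟩ := ENNReal.lt_iff_exists_real_btwn.1 ha
      have hb : stheta φ w x < b := (ENNReal.ofReal_lt_ofReal_iff_of_nonneg stheta_nonneg).1 hb
      have ht : Tendsto (fun n => ENNReal.ofReal b * (amod φ w (fun i => tl x n i / b) + 1)) atTop
          (𝓝 (ENNReal.ofReal b * (0 + 1))) :=
        ENNReal.Tendsto.const_mul ((hev hb).add_const 1) (Or.inr ENNReal.ofReal_ne_top)
      rw [zero_add, mul_one] at ht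
      filter_upwards [ht.eventually (gt_mem_nhds hba)] with n hn
      exact lt_of_le_of_lt (sorl_le hφ hw _ (hpos hb)) hn

end OL
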